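/- In an H4-free 3-hypertournament, fix elements a, b and let φ(x,y) denote R(x,y,a) ∧ R(x,b,y). Then there do not exist elements c₀, c₁, c₂ (pairwise distinct, distinct from a and b) such that φ(c₀,c₁), φ(c₁,c₂), and φ(c₂,c₀) all hold. -/

import Mathlib

/-- A 3-hypertournament structure on `V`. -/
def IsHT {V : Type*} (R : V → V → V → Prop) : Prop :=
  (∀ a b c : V, R a b c → a ≠ b ∧ b ≠ c ∧ a ≠ c) ∧
  (∀ a b c : V, R a b c → R b c a) ∧
  (∀ a b c : V, a ≠ b → b ≠ c → a ≠ c → (¬ R a b c ↔ R c b a))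

/-- No 4 points form a copy of H4. -/
def H4Free {V : Type*} (R : V → V → V → Prop) : Prop :=
  ∀ a b c d : V, ¬ (R a b c ∧ R a c d ∧ R a d b ∧ R b d c)

/-- In an H4-free 3-hypertournament, with `φ(x,y) := R x y a ∧ R x b y`,
there are no `c₀, c₁, c₂` (pairwise distinct, distinct from `a` and `b`) with
`φ(c₀,c₁) ∧ φ(c₁,c₂) ∧ φ(c₂,c₀)`. -/
theorem stmt_6 {V : Type*} (R : V → V → V → Prop) (hHT : IsHT R) (hfree : H4Free R)
    (a b : V) (hab : a ≠ b) :
    ¬ ∃ c₀ c₁ c₂ : V,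
        (c₀ ≠ c₁ ∧ c₁ ≠ c₂ ∧ c₀ ≠ c₂ ∧
         c₀ ≠ a ∧ c₀ ≠ b ∧ c₁ ≠ a ∧ c₁ ≠ b ∧ c₂ ≠ a ∧ c₂ ≠ b) ∧
        (R c₀ c₁ a ∧ R c₀ b c₁) ∧ (R c₁ c₂ a ∧ R c₁ b c₂) ∧ (R c₂ c₀ a ∧ R c₂ b c₀) := by
  obtain ⟨-, hcyc, hrev⟩ := hHT
  rintro ⟨c₀, c₁, c₂, ⟨h01, h12, h02, -⟩, ⟨h01a, h0b1⟩, ⟨h12a, h1b2⟩, ⟨h20a, h2b0⟩⟩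
  have rot {x y z : V} (h : R x y z) : R z x y := hcyc _ _ _ (hcyc _ _ _ h)
  by_cases h : R c₀ c₁ c₂
  · exact hfree b c₀ c₂ c₁ ⟨hcyc _ _ _ h2b0,
      hcyc _ _ _ h1b2, hcyc _ _ _ h0b1, h⟩
  · exact hfree a c₀ c₁ c₂ ⟨rot h01a, rot h12a, rot h20a, rot ((hrev _ _ _ h01 h12 h02).1 h)⟩
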